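/- arXiv:2605.06867 — 3 statements merged into one kernel-verified Lean document; each statement's English description precedes it below -/
import Mathlib

section
/- Let ε > 0, α > 0 and fix y ∈ ℝ³. Then for every smooth compactly supported function φ : ℝ³ → ℝ one has ∫_{ℝ³} (ε² Δφ(x) − α² φ(x)) 𝒢_ε(x,y) dx = −φ(y). (That is, 𝒢_ε is a distributional fundamental solution of the screened Helmholtz operator ε²Δ − α².) -/
open MeasureTheory Real Filter
open scoped ENNReal

noncomputable section

/-- The screened Coulomb (Yukawa) kernel on ℝ³.  Note that at `x = y` the
formula evaluates (with Lean's convention `1/0 = 0`) to `0`, matching the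
convention `𝒢_ε(x,x) = 0`. -/
def yukawa (ε α : ℝ) (x y : EuclideanSpace ℝ (Fin 3)) : ℝ :=
  Real.exp (-(α / ε) * ‖x - y‖) / (4 * π * ε ^ 2 * ‖x - y‖)

/-- The Laplacian of `φ : ℝ³ → ℝ`: the sum of the second partial derivatives. -/
def lap (φ : EuclideanSpace ℝ (Fin 3) → ℝ) (x : EuclideanSpace ℝ (Fin 3)) : ℝ :=
  ∑ i : Fin 3,
    fderiv ℝ (fun z => fderiv ℝ φ z (EuclideanSpace.single i 1)) x (EuclideanSpace.single i 1)

/-- Integration by parts in direction `v` against a compactly supported `C¹` function. -/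
lemma integral_fderiv_mul_eq_neg {E : Type*} [NormedAddCommGroup E] [NormedSpace ℝ E]
    [FiniteDimensional ℝ E] [MeasurableSpace E] [BorelSpace E] {μ : Measure E}
    [μ.IsAddHaarMeasure] {φ g g' : E → ℝ} {v : E}
    (hφ : ContDiff ℝ 1 φ) (hφc : HasCompactSupport φ) (hg : Continuous g) (hg' : Continuous g')
    (h : ∀ x, HasLineDerivAt ℝ g (g' x) x v) :
    ∫ x, fderiv ℝ φ x v * g x ∂μ = -∫ x, φ x * g' x ∂μ := by
  have hdφ : Continuous fun x => fderiv ℝ φ x v :=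
    (hφ.continuous_fderiv one_ne_zero).clm_apply continuous_const
  have key := integral_bilinear_hasLineDerivAt_right_eq_neg_left_of_integrable (μ := μ)
    (B := ContinuousLinearMap.mul ℝ ℝ) (f := φ) (f' := fun x => fderiv ℝ φ x v) (g := g)
    (g' := g') (v := v)
    ((hdφ.mul hg).integrable_of_hasCompactSupport (hφc.fderiv_apply (𝕜 := ℝ) v).mul_right)
    ((hφ.continuous.mul hg').integrable_of_hasCompactSupport hφc.mul_right)
    ((hφ.continuous.mul hg).integrable_of_hasCompactSupport hφc.mul_right)
    (fun x _ => ((hφ.differentiable one_ne_zero) x).hasFDerivAt.hasLineDerivAt v)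
    (fun x _ => h x)
  simp only [ContinuousLinearMap.mul_apply'] at key
  rw [key, neg_neg]

lemma hasLineDerivAt_comp_norm_sub_sq {h h₁ : ℝ → ℝ} (hh : ∀ t, 0 ≤ t → HasDerivAt h (h₁ t) t)
    (x y : EuclideanSpace ℝ (Fin 3)) (i : Fin 3) :
    HasLineDerivAt ℝ (fun x => h (‖x - y‖ ^ 2)) (2 * (x - y) i * h₁ (‖x - y‖ ^ 2)) x
      (EuclideanSpace.single i 1) := by
  have h1 : HasFDerivAt (fun x : EuclideanSpace ℝ (Fin 3) => ‖x - y‖ ^ 2) _ x :=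
    ((hasFDerivAt_id x).sub_const y).norm_sq
  have h2 := ((hh (‖x - y‖ ^ 2) (by positivity)).comp_hasFDerivAt x h1).hasLineDerivAt
    (EuclideanSpace.single i 1)
  refine HasDerivAt.congr_deriv h2 ?_
  simp [EuclideanSpace.inner_single_right]
  ring

lemma hasLineDerivAt_sub_apply (x y : EuclideanSpace ℝ (Fin 3)) (i : Fin 3) :
    HasLineDerivAt ℝ (fun x : EuclideanSpace ℝ (Fin 3) => (x - y) i) 1 x
      (EuclideanSpace.single i 1) := by
  have h1 : HasFDerivAt (fun x : EuclideanSpace ℝ (Fin 3) => (x - y) i) _ x :=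
    (EuclideanSpace.proj (𝕜 := ℝ) i).hasFDerivAt.comp x ((hasFDerivAt_id x).sub_const y)
  refine HasDerivAt.congr_deriv (h1.hasLineDerivAt (EuclideanSpace.single i 1)) ?_
  simp

/-- Green's identity against a smooth radial function `h(|x-y|²)`. -/
lemma integral_lap_mul_comp_norm_sub_sq {φ : EuclideanSpace ℝ (Fin 3) → ℝ}
    (hφ : ContDiff ℝ 2 φ) (hφc : HasCompactSupport φ) (y : EuclideanSpace ℝ (Fin 3))
    {h h₁ h₂ : ℝ → ℝ} (hh : ∀ t, 0 ≤ t → HasDerivAt h (h₁ t) t)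
    (hh₁ : ∀ t, 0 ≤ t → HasDerivAt h₁ (h₂ t) t) (hh₂ : ∀ t, 0 ≤ t → ContinuousAt h₂ t) :
    ∫ x, lap φ x * h (‖x - y‖ ^ 2) =
      ∫ x, φ x * (6 * h₁ (‖x - y‖ ^ 2) + 4 * ‖x - y‖ ^ 2 * h₂ (‖x - y‖ ^ 2)) := by
  have comp_cont : ∀ f : ℝ → ℝ, (∀ t, 0 ≤ t → ContinuousAt f t) →
      Continuous fun x : EuclideanSpace ℝ (Fin 3) => f (‖x - y‖ ^ 2) := fun f hf =>
    continuous_iff_continuousAt.2 fun x =>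
      ContinuousAt.comp (f := fun x : EuclideanSpace ℝ (Fin 3) => ‖x - y‖ ^ 2)
        (hf _ (by positivity)) (by fun_prop)
  have c0 := comp_cont h fun t ht => (hh t ht).continuousAt
  have c1 := comp_cont h₁ fun t ht => (hh₁ t ht).continuousAt
  have c2 := comp_cont h₂ hh₂
  have ci : ∀ i : Fin 3, Continuous fun x : EuclideanSpace ℝ (Fin 3) => (x - y) i :=
    fun i => by fun_prop
  have ct : ∀ i : Fin 3, Continuous fun x : EuclideanSpace ℝ (Fin 3) =>
      2 * h₁ (‖x - y‖ ^ 2) + 4 * ((x - y) i) ^ 2 * h₂ (‖x - y‖ ^ 2) := fun i =>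
    (continuous_const.mul c1).add ((continuous_const.mul ((ci i).pow 2)).mul c2)
  have hd : ∀ v, ContDiff ℝ 1 fun z => fderiv ℝ φ z v := fun v =>
    (hφ.fderiv_right (m := 1) (by norm_num)).clm_apply contDiff_const
  have hdc : ∀ v, HasCompactSupport fun z => fderiv ℝ φ z v := fun v => hφc.fderiv_apply (𝕜 := ℝ) v
  have one : ∀ i : Fin 3,
      ∫ x, fderiv ℝ (fun z => fderiv ℝ φ z (EuclideanSpace.single i 1)) x
        (EuclideanSpace.single i 1) * h (‖x - y‖ ^ 2) =
      ∫ x, φ x * (2 * h₁ (‖x - y‖ ^ 2) + 4 * ((x - y) i) ^ 2 * h₂ (‖x - y‖ ^ 2)) := fun i => by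
    rw [integral_fderiv_mul_eq_neg (g' := fun x => 2 * (x - y) i * h₁ (‖x - y‖ ^ 2)) (hd _) (hdc _)
      c0 ((continuous_const.mul (ci i)).mul c1) (fun x => hasLineDerivAt_comp_norm_sub_sq hh x y i),
      integral_fderiv_mul_eq_neg (g := fun x => 2 * (x - y) i * h₁ (‖x - y‖ ^ 2))
      (g' := fun x => 2 * h₁ (‖x - y‖ ^ 2) + 4 * ((x - y) i) ^ 2 * h₂ (‖x - y‖ ^ 2))
      (hφ.of_le (by norm_num)) hφc ((continuous_const.mul (ci i)).mul c1) (ct i), neg_neg]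
    intro x
    have := HasDerivAt.mul (HasDerivAt.const_mul 2 (hasLineDerivAt_sub_apply x y i))
      (hasLineDerivAt_comp_norm_sub_sq hh₁ x y i)
    refine HasDerivAt.congr_deriv this ?_
    simp
    ring
  have hi1 : ∀ i ∈ Finset.univ, Integrable fun x : EuclideanSpace ℝ (Fin 3) =>
      fderiv ℝ (fun z => fderiv ℝ φ z (EuclideanSpace.single i 1)) x
        (EuclideanSpace.single i (1 : ℝ)) * h (‖x - y‖ ^ 2) := fun i _ =>
    (((hd _).continuous_fderiv one_ne_zero).clm_apply continuous_const).mul c0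
      |>.integrable_of_hasCompactSupport ((hdc _).fderiv_apply (𝕜 := ℝ) _).mul_right
  have hi2 : ∀ i ∈ Finset.univ, Integrable fun x : EuclideanSpace ℝ (Fin 3) =>
      φ x * (2 * h₁ (‖x - y‖ ^ 2) + 4 * ((x - y) i) ^ 2 * h₂ (‖x - y‖ ^ 2)) := fun i _ =>
    (hφ.continuous.mul (ct i)).integrable_of_hasCompactSupport hφc.mul_right
  simp only [lap, Finset.sum_mul]
  rw [integral_finsetSum _ hi1, Finset.sum_congr rfl fun i _ => one i, ← integral_finsetSum _ hi2]
  congr 1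
  ext x
  have : ‖x - y‖ ^ 2 * h₂ (‖x - y‖ ^ 2)
      = ((x - y) 0 ^ 2 + (x - y) 1 ^ 2 + (x - y) 2 ^ 2) * h₂ (‖x - y‖ ^ 2) := by
    congr 1
    rw [EuclideanSpace.real_norm_sq_eq, Fin.sum_univ_three]
  rw [Fin.sum_univ_three]
  linear_combination (- 4 * φ x) * this

lemma continuous_lap {φ : EuclideanSpace ℝ (Fin 3) → ℝ} (hφ : ContDiff ℝ 2 φ) :
    Continuous (lap φ) :=
  continuous_finsetSum _ fun _ _ => (((hφ.fderiv_right (m := 1) (by norm_num)).clm_apply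
    contDiff_const).continuous_fderiv one_ne_zero).clm_apply continuous_const

lemma hasCompactSupport_lap {φ : EuclideanSpace ℝ (Fin 3) → ℝ} (hφc : HasCompactSupport φ) :
    HasCompactSupport (lap φ) := by
  have h : ∀ i : Fin 3, HasCompactSupport fun x =>
      fderiv ℝ (fun z => fderiv ℝ φ z (EuclideanSpace.single i 1)) x
        (EuclideanSpace.single i (1 : ℝ)) :=
    fun i => (hφc.fderiv_apply (𝕜 := ℝ) _).fderiv_apply (𝕜 := ℝ) _
  have hl : lap φ = _ := funext fun x => Fin.sum_univ_three _
  rw [hl]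
  exact ((h 0).add (h 1)).add (h 2)

lemma hasDerivAt_sqrt_add_sq {d t : ℝ} (hd : 0 < d) (ht : 0 ≤ t) :
    HasDerivAt (fun t => √(t + d ^ 2)) (1 / (2 * √(t + d ^ 2))) t :=
  ((hasDerivAt_id t).add_const _).sqrt (by positivity)

lemma hasDerivAt_exp_neg_mul_sqrt {k d t : ℝ} (hd : 0 < d) (ht : 0 ≤ t) :
    HasDerivAt (fun t => exp (-k * √(t + d ^ 2)))
      (exp (-k * √(t + d ^ 2)) * (-k * (1 / (2 * √(t + d ^ 2))))) t :=
  ((hasDerivAt_sqrt_add_sq hd ht).const_mul (-k)).exp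

/-- The regularised Yukawa profile satisfies the screened Poisson equation up to a concentrating
remainder. -/
lemma integral_lap_sub_mul_regularised {φ : EuclideanSpace ℝ (Fin 3) → ℝ}
    (hφ : ContDiff ℝ 2 φ) (hφc : HasCompactSupport φ) (y : EuclideanSpace ℝ (Fin 3))
    {k d : ℝ} (hd : 0 < d) :
    ∫ x, (lap φ x - k ^ 2 * φ x) *
        (exp (-k * √(‖x - y‖ ^ 2 + d ^ 2)) / √(‖x - y‖ ^ 2 + d ^ 2)) =
      -∫ x, φ x * (d ^ 2 * (k ^ 2 / √(‖x - y‖ ^ 2 + d ^ 2) ^ 3 +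
        3 * k / √(‖x - y‖ ^ 2 + d ^ 2) ^ 4 + 3 / √(‖x - y‖ ^ 2 + d ^ 2) ^ 5) *
        exp (-k * √(‖x - y‖ ^ 2 + d ^ 2))) := by
  have spos : ∀ t : ℝ, 0 ≤ t → 0 < √(t + d ^ 2) := fun t ht => sqrt_pos.2 (by positivity)
  have green := integral_lap_mul_comp_norm_sub_sq hφ hφc y
    (h := fun t => exp (-k * √(t + d ^ 2)) / √(t + d ^ 2))
    (h₁ := fun t => -(k / √(t + d ^ 2) ^ 2 + 1 / √(t + d ^ 2) ^ 3) *
      exp (-k * √(t + d ^ 2)) / 2)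
    (h₂ := fun t => (k ^ 2 / √(t + d ^ 2) ^ 3 + 3 * k / √(t + d ^ 2) ^ 4 +
      3 / √(t + d ^ 2) ^ 5) * exp (-k * √(t + d ^ 2)) / 4)
    (fun t ht => by
      have hs := (spos t ht).ne'
      refine ((hasDerivAt_exp_neg_mul_sqrt hd ht).div
        (hasDerivAt_sqrt_add_sq hd ht) hs).congr_deriv ?_
      field_simp
      ring)
    (fun t ht => by
      have hs := (spos t ht).ne'
      have h0 := hasDerivAt_sqrt_add_sq hd ht
      refine (((((hasDerivAt_const t k).div (h0.pow 2) (by simpa using hs)).add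
        ((hasDerivAt_const t (1 : ℝ)).div (h0.pow 3) (by simpa using hs))).neg.mul
        (hasDerivAt_exp_neg_mul_sqrt hd ht)).div_const 2).congr_deriv ?_
      simp
      field_simp
      ring)
    (fun t ht => by
      have hs := (spos t ht).ne'
      fun_prop (disch := simp [hs]))
  have hs0 : ∀ x : EuclideanSpace ℝ (Fin 3), √(‖x - y‖ ^ 2 + d ^ 2) ≠ 0 :=
    fun x => (spos _ (by positivity)).ne'
  have hgc : Continuous fun x : EuclideanSpace ℝ (Fin 3) =>
      exp (-k * √(‖x - y‖ ^ 2 + d ^ 2)) / √(‖x - y‖ ^ 2 + d ^ 2) := by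
    fun_prop (disch := exact hs0)
  have hrc : Continuous fun x : EuclideanSpace ℝ (Fin 3) =>
      d ^ 2 * (k ^ 2 / √(‖x - y‖ ^ 2 + d ^ 2) ^ 3 +
        3 * k / √(‖x - y‖ ^ 2 + d ^ 2) ^ 4 + 3 / √(‖x - y‖ ^ 2 + d ^ 2) ^ 5) *
        exp (-k * √(‖x - y‖ ^ 2 + d ^ 2)) := by
    fun_prop (disch := exact fun x => pow_ne_zero _ (hs0 x))
  have i1 : Integrable fun x => lap φ x *
      (exp (-k * √(‖x - y‖ ^ 2 + d ^ 2)) / √(‖x - y‖ ^ 2 + d ^ 2)) :=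
    ((continuous_lap hφ).mul hgc).integrable_of_hasCompactSupport
      (hasCompactSupport_lap hφc).mul_right
  have i2 : Integrable fun x => k ^ 2 * (φ x *
      (exp (-k * √(‖x - y‖ ^ 2 + d ^ 2)) / √(‖x - y‖ ^ 2 + d ^ 2))) :=
    ((hφ.continuous.mul hgc).integrable_of_hasCompactSupport hφc.mul_right).const_mul _
  have i3 : Integrable fun x => φ x * (d ^ 2 * (k ^ 2 / √(‖x - y‖ ^ 2 + d ^ 2) ^ 3 +
        3 * k / √(‖x - y‖ ^ 2 + d ^ 2) ^ 4 + 3 / √(‖x - y‖ ^ 2 + d ^ 2) ^ 5) *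
        exp (-k * √(‖x - y‖ ^ 2 + d ^ 2))) :=
    (hφ.continuous.mul hrc).integrable_of_hasCompactSupport hφc.mul_right
  simp only [sub_mul, mul_assoc (k ^ 2)]
  rw [integral_sub i1 i2, green, sub_eq_iff_eq_add, ← integral_neg]
  refine Eq.trans ?_ (integral_add i3.neg i2)
  congr 1
  ext x
  have hs := hs0 x
  have ht : ‖x - y‖ ^ 2 = √(‖x - y‖ ^ 2 + d ^ 2) ^ 2 - d ^ 2 := by
    rw [sq_sqrt (by positivity)]; ring
  generalize √(‖x - y‖ ^ 2 + d ^ 2) = s at *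
  rw [ht]
  field_simp
  ring

lemma integral_three_div_sqrt_pow_five :
    ∫ u : EuclideanSpace ℝ (Fin 3), 3 / √(‖u‖ ^ 2 + 1) ^ 5 = 4 * π := by
  rw [integral_fun_norm_addHaar volume (fun r : ℝ => 3 / √(r ^ 2 + 1) ^ 5)]
  have hs : ∀ r : ℝ, √(r ^ 2 + 1) ≠ 0 := fun r => (sqrt_pos.2 (by positivity)).ne'
  have hrad : ∫ r in Set.Ioi (0 : ℝ), r ^ 2 * (3 / √(r ^ 2 + 1) ^ 5) = 1 := by
    have hderiv : ∀ r ∈ Set.Ici (0 : ℝ), HasDerivAt (fun r => (r / √(r ^ 2 + 1)) ^ 3)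
        (r ^ 2 * (3 / √(r ^ 2 + 1) ^ 5)) r := fun r _ => by
      have h0 : HasDerivAt (fun r : ℝ => √(r ^ 2 + 1)) _ r :=
        (((hasDerivAt_id r).pow 2).add_const 1).sqrt (by simp; positivity)
      refine (((hasDerivAt_id r).div h0 (hs r)).pow 3).congr_deriv ?_
      have h1 := hs r
      have h2 : r ^ 2 = √(r ^ 2 + 1) ^ 2 - 1 := by rw [sq_sqrt (by positivity)]; ring
      simp
      generalize √(r ^ 2 + 1) = s at *
      field_simp
      linear_combination (-r ^ 2) * h2
    have hlim : Tendsto (fun r : ℝ => (r / √(r ^ 2 + 1)) ^ 3) atTop (nhds 1) := by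
      have h1 : Tendsto (fun r : ℝ => (√(1 + (r ^ 2)⁻¹))⁻¹ ^ 3) atTop
          (nhds ((√(1 + 0))⁻¹ ^ 3)) :=
        (((tendsto_inv_atTop_zero.comp (tendsto_pow_atTop two_ne_zero)).const_add 1).sqrt.inv₀
          (by simp)).pow 3
      simp only [add_zero, sqrt_one, inv_one, one_pow] at h1
      refine h1.congr' ?_
      filter_upwards [eventually_gt_atTop 0] with r hr
      congr 1
      rw [show r ^ 2 + 1 = r ^ 2 * (1 + (r ^ 2)⁻¹) by field_simp, sqrt_mul (by positivity),
        sqrt_sq hr.le]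
      field_simp
    rw [integral_Ioi_of_hasDerivAt_of_nonneg' hderiv (fun r _ => by positivity) hlim]
    simp
  simp only [finrank_euclideanSpace, Fintype.card_fin, smul_eq_mul, Nat.add_one_sub_one, hrad]
  rw [Measure.real, EuclideanSpace.volume_ball_fin_three]
  rw [ENNReal.toReal_mul, ENNReal.toReal_ofReal (by positivity)]
  simp
  ring

lemma integrable_inv_sqrt_pow_five :
    Integrable fun u : EuclideanSpace ℝ (Fin 3) => 8 / √(‖u‖ ^ 2 + 1) ^ 5 := by
  by_contra h
  have h3 : ¬ Integrable fun u : EuclideanSpace ℝ (Fin 3) => 3 / √(‖u‖ ^ 2 + 1) ^ 5 := fun h3 =>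
    h ((h3.const_mul (8 / 3)).congr (ae_of_all _ fun u => by ring))
  have := integral_three_div_sqrt_pow_five
  rw [integral_undef h3] at this
  exact pi_ne_zero (by linarith)

lemma tendsto_integral_remainder {φ : EuclideanSpace ℝ (Fin 3) → ℝ}
    (hφ : Continuous φ) (hφc : HasCompactSupport φ) (y : EuclideanSpace ℝ (Fin 3))
    {k : ℝ} (hk : 0 < k) :
    Tendsto (fun d : ℝ => ∫ x, φ x * (d ^ 2 * (k ^ 2 / √(‖x - y‖ ^ 2 + d ^ 2) ^ 3 +
        3 * k / √(‖x - y‖ ^ 2 + d ^ 2) ^ 4 + 3 / √(‖x - y‖ ^ 2 + d ^ 2) ^ 5) *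
        exp (-k * √(‖x - y‖ ^ 2 + d ^ 2)))) (nhdsWithin 0 (Set.Ioi 0)) (nhds (4 * π * φ y)) := by
  obtain ⟨C, hC⟩ := hφ.bounded_above_of_compact_support hφc
  have hs0 : ∀ u : EuclideanSpace ℝ (Fin 3), √(‖u‖ ^ 2 + 1) ≠ 0 :=
    fun u => (sqrt_pos.2 (by positivity)).ne'
  have key : Tendsto (fun d : ℝ => ∫ u : EuclideanSpace ℝ (Fin 3), φ (y + d • u) *
      ((k ^ 2 * d ^ 2 / √(‖u‖ ^ 2 + 1) ^ 3 + 3 * k * d / √(‖u‖ ^ 2 + 1) ^ 4 +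
        3 / √(‖u‖ ^ 2 + 1) ^ 5) * exp (-(k * d * √(‖u‖ ^ 2 + 1))))) (nhdsWithin 0 (Set.Ioi 0))
      (nhds (∫ u : EuclideanSpace ℝ (Fin 3), φ y * (3 / √(‖u‖ ^ 2 + 1) ^ 5))) := by
    refine tendsto_integral_filter_of_dominated_convergence
      (fun u => C * (8 / √(‖u‖ ^ 2 + 1) ^ 5)) ?_ ?_
      (integrable_inv_sqrt_pow_five.const_mul C) ?_
    · refine Eventually.of_forall fun d => Continuous.aestronglyMeasurable ?_
      fun_prop (disch := exact fun x => pow_ne_zero _ (hs0 x))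
    · filter_upwards [self_mem_nhdsWithin] with d (hd : 0 < d)
      refine ae_of_all _ fun u => ?_
      rw [norm_mul]
      refine mul_le_mul (hC _) ?_ (norm_nonneg _) ((norm_nonneg _).trans (hC 0))
      have hs : 0 < √(‖u‖ ^ 2 + 1) := sqrt_pos.2 (by positivity)
      generalize √(‖u‖ ^ 2 + 1) = s at *
      rw [Real.norm_of_nonneg (by positivity), le_div_iff₀ (by positivity)]
      have hq := quadratic_le_exp_of_nonneg (x := k * d * s) (by positivity)
      have e1 : (k ^ 2 * d ^ 2 / s ^ 3 + 3 * k * d / s ^ 4 + 3 / s ^ 5) * exp (-(k * d * s)) * s ^ 5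
          = ((k * d * s) ^ 2 + 3 * (k * d * s) + 3) / exp (k * d * s) := by
        rw [exp_neg]; field_simp
      rw [e1, div_le_iff₀ (exp_pos _)]
      have : 0 < k * d * s := by positivity
      nlinarith
    · refine ae_of_all _ fun u => ?_
      have hc : Continuous fun d : ℝ => φ (y + d • u) *
          ((k ^ 2 * d ^ 2 / √(‖u‖ ^ 2 + 1) ^ 3 + 3 * k * d / √(‖u‖ ^ 2 + 1) ^ 4 +
          3 / √(‖u‖ ^ 2 + 1) ^ 5) * exp (-(k * d * √(‖u‖ ^ 2 + 1)))) := by fun_prop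
      simpa using (hc.tendsto 0).mono_left nhdsWithin_le_nhds
  rw [integral_const_mul, integral_three_div_sqrt_pow_five, mul_comm (φ y)] at key
  refine key.congr' ?_
  filter_upwards [self_mem_nhdsWithin] with d (hd : 0 < d)
  symm
  rw [← integral_add_left_eq_self _ y]
  have hscale := Measure.integral_comp_smul_of_nonneg (volume : Measure (EuclideanSpace ℝ (Fin 3)))
    (fun x => φ (y + x) * (d ^ 2 * (k ^ 2 / √(‖y + x - y‖ ^ 2 + d ^ 2) ^ 3 +
        3 * k / √(‖y + x - y‖ ^ 2 + d ^ 2) ^ 4 + 3 / √(‖y + x - y‖ ^ 2 + d ^ 2) ^ 5) *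
        exp (-k * √(‖y + x - y‖ ^ 2 + d ^ 2)))) d (hR := hd.le)
  rw [finrank_euclideanSpace, Fintype.card_fin, smul_eq_mul, eq_inv_mul_iff_mul_eq₀ (by positivity),
    ← integral_const_mul] at hscale
  rw [← hscale]
  congr 1
  ext u
  have hr : √(‖y + d • u - y‖ ^ 2 + d ^ 2) = d * √(‖u‖ ^ 2 + 1) := by
    rw [add_sub_cancel_left, norm_smul, Real.norm_of_nonneg hd.le,
      show (d * ‖u‖) ^ 2 + d ^ 2 = d ^ 2 * (‖u‖ ^ 2 + 1) by ring, sqrt_mul (by positivity),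
      sqrt_sq hd.le]
  rw [hr]
  have hs := hs0 u
  generalize √(‖u‖ ^ 2 + 1) = s at *
  rw [show -k * (d * s) = -(k * d * s) by ring]
  field_simp

lemma locallyIntegrable_inv_norm_sub (y : EuclideanSpace ℝ (Fin 3)) :
    LocallyIntegrable fun x : EuclideanSpace ℝ (Fin 3) => ‖x - y‖⁻¹ := by
  rw [locallyIntegrable_iff]
  intro K hK
  obtain ⟨R, hR⟩ := hK.isBounded.subset_ball y
  refine IntegrableOn.mono_set ?_ hR
  have h0 : IntegrableOn (fun x : EuclideanSpace ℝ (Fin 3) => ‖x‖⁻¹) (Metric.ball 0 R) := by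
    rw [integrableOn_fun_norm_addHaar volume (f := fun r => r⁻¹)]
    refine ((continuous_id.integrableOn_Icc (a := 0) (b := R)).mono_set
      Set.Ioo_subset_Icc_self).congr_fun (fun r hr => ?_) measurableSet_Ioo
    have := hr.1.ne'
    simp
    field_simp
  have h1 := (measurePreserving_sub_right (volume : Measure (EuclideanSpace ℝ (Fin 3))) y)
    |>.integrableOn_comp_preimage (Homeomorph.subRight y).measurableEmbedding
    (f := fun x => ‖x‖⁻¹) (s := Metric.ball 0 R)
  have hpre : (fun x => x - y) ⁻¹' Metric.ball 0 R = Metric.ball y R := by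
    ext x
    simp [dist_eq_norm]
  rw [hpre] at h1
  exact h1.2 h0

lemma tendsto_integral_mul_regularised {ψ : EuclideanSpace ℝ (Fin 3) → ℝ}
    (hψ : Continuous ψ) (hψc : HasCompactSupport ψ) (y : EuclideanSpace ℝ (Fin 3))
    {k : ℝ} (hk : 0 < k) :
    Tendsto (fun d : ℝ => ∫ x, ψ x *
        (exp (-k * √(‖x - y‖ ^ 2 + d ^ 2)) / √(‖x - y‖ ^ 2 + d ^ 2)))
      (nhdsWithin 0 (Set.Ioi 0)) (nhds (∫ x, ψ x * (exp (-k * ‖x - y‖) / ‖x - y‖))) := by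
  have hne : ∀ᵐ x : EuclideanSpace ℝ (Fin 3), x ≠ y := by
    simp [ae_iff]
  refine tendsto_integral_filter_of_dominated_convergence (fun x => ‖ψ x * ‖x - y‖⁻¹‖) ?_ ?_
    ?_ ?_
  · filter_upwards [self_mem_nhdsWithin] with d (hd : 0 < d)
    refine Continuous.aestronglyMeasurable ?_
    fun_prop (disch := exact fun x => (sqrt_pos.2 (by positivity)).ne')
  · filter_upwards [self_mem_nhdsWithin] with d (hd : 0 < d)
    filter_upwards [hne] with x hx
    rw [norm_mul, norm_mul]
    gcongr
    have hpos : 0 < ‖x - y‖ := norm_pos_iff.2 (sub_ne_zero.2 hx)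
    have hle : ‖x - y‖ ≤ √(‖x - y‖ ^ 2 + d ^ 2) := le_sqrt_of_sq_le (by nlinarith)
    rw [Real.norm_of_nonneg (by positivity), Real.norm_of_nonneg (by positivity), ← one_div]
    gcongr
    exact exp_le_one_iff.2 (by nlinarith)
  · exact (((locallyIntegrable_inv_norm_sub y).integrable_smul_left_of_hasCompactSupport
      hψ hψc)).norm
  · filter_upwards [hne] with x hx
    have hpos : 0 < ‖x - y‖ := norm_pos_iff.2 (sub_ne_zero.2 hx)
    have hc : ContinuousAt (fun d : ℝ => ψ x *
        (exp (-k * √(‖x - y‖ ^ 2 + d ^ 2)) / √(‖x - y‖ ^ 2 + d ^ 2))) 0 := by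
      have : √(‖x - y‖ ^ 2 + 0 ^ 2) ≠ 0 := by simpa using hpos.ne'
      fun_prop (disch := assumption)
    have := hc.tendsto.mono_left (nhdsWithin_le_nhds (s := Set.Ioi 0))
    simpa using this

/-- `exp(-k|x-y|)/|x-y|` is `4π` times the fundamental solution of `k² - Δ`. -/
lemma integral_lap_sub_mul_exp_div_norm {φ : EuclideanSpace ℝ (Fin 3) → ℝ}
    (hφ : ContDiff ℝ 2 φ) (hφc : HasCompactSupport φ) (y : EuclideanSpace ℝ (Fin 3))
    {k : ℝ} (hk : 0 < k) :
    ∫ x, (lap φ x - k ^ 2 * φ x) * (exp (-k * ‖x - y‖) / ‖x - y‖) = -(4 * π * φ y) := by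
  have hc : Continuous fun x => lap φ x - k ^ 2 * φ x :=
    (continuous_lap hφ).sub (continuous_const.mul hφ.continuous)
  have hs : HasCompactSupport fun x => lap φ x - k ^ 2 * φ x :=
    (hasCompactSupport_lap hφc).sub (hφc.mul_left (f := fun _ => k ^ 2))
  refine tendsto_nhds_unique (tendsto_integral_mul_regularised hc hs y hk) ?_
  refine (tendsto_integral_remainder hφ.continuous hφc y hk).neg.congr' ?_
  filter_upwards [self_mem_nhdsWithin] with d hd
  exact (integral_lap_sub_mul_regularised hφ hφc y hd).symm

theorem yukawa_fundamental_solution (ε α : ℝ) (hε : 0 < ε) (hα : 0 < α)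
    (y : EuclideanSpace ℝ (Fin 3)) (φ : EuclideanSpace ℝ (Fin 3) → ℝ)
    (hφ : ContDiff ℝ (⊤ : ℕ∞) φ) (hφc : HasCompactSupport φ) :
    ∫ x, (ε ^ 2 * lap φ x - α ^ 2 * φ x) * yukawa ε α x y = -φ y := by
  have h := integral_lap_sub_mul_exp_div_norm (by exact_mod_cast contDiff_infty.1 hφ 2) hφc y
    (div_pos hα hε)
  have hpt : ∀ x, (ε ^ 2 * lap φ x - α ^ 2 * φ x) * yukawa ε α x y =
      (4 * π)⁻¹ * ((lap φ x - (α / ε) ^ 2 * φ x) * (exp (-(α / ε) * ‖x - y‖) / ‖x - y‖)) := by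
    intro x
    rw [yukawa, ← div_div, div_right_comm]
    generalize exp (-(α / ε) * ‖x - y‖) / ‖x - y‖ = e
    field_simp
  simp only [hpt]
  rw [integral_const_mul, h]
  field_simp
end
end

section
/- Let ε > 0, α > 0 and let μ be a Borel measure on ℝ³ which is upper 2-regular with constant A > 0. Then for every x ∈ ℝ³ one has ∫_{ℝ³} 𝒢_ε(x,y) dμ(y) ≤ A/(2π α ε). -/
open MeasureTheory Real Filter
open scoped ENNReal

noncomputable section

/-- A Borel measure `μ` on ℝ³ is upper 2-regular with constant `A` if
`μ(B̄(x,r)) ≤ A r²` for every center `x` and radius `r > 0`. -/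
def Upper2Regular (μ : Measure (EuclideanSpace ℝ (Fin 3))) (A : ℝ) : Prop :=
  ∀ (x : EuclideanSpace ℝ (Fin 3)) (r : ℝ), 0 < r →
    μ (Metric.closedBall x r) ≤ ENNReal.ofReal (A * r ^ 2)

theorem lintegral_Ioi_ofReal_of_hasDerivAt_of_nonneg {g g' : ℝ → ℝ} {b l : ℝ}
    (hderiv : ∀ s ∈ Set.Ici b, HasDerivAt g (g' s) s) (hpos : ∀ s ∈ Set.Ioi b, 0 ≤ g' s)
    (hlim : Tendsto g atTop (nhds l)) :
    ∫⁻ s in Set.Ioi b, ENNReal.ofReal (g' s) = ENNReal.ofReal (l - g b) := by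
  rw [← integral_Ioi_of_hasDerivAt_of_nonneg' hderiv hpos hlim,
    ofReal_integral_eq_lintegral_ofReal
      (integrableOn_Ioi_deriv_of_nonneg' hderiv hpos hlim)
      ((ae_restrict_iff' measurableSet_Ioi).2 (Eventually.of_forall hpos))]

/-- The negative of the derivative of the profile `s ↦ exp (-a s) / (C s)`. -/
def yukawaSlope (a C s : ℝ) : ℝ := Real.exp (-a * s) * (a / s + 1 / s ^ 2) / C

theorem measurable_yukawaSlope (a C : ℝ) : Measurable (yukawaSlope a C) := by
  unfold yukawaSlope
  fun_prop

theorem yukawaSlope_nonneg {a C s : ℝ} (ha : 0 ≤ a) (hC : 0 ≤ C) (hs : 0 ≤ s) :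
    0 ≤ yukawaSlope a C s := by
  unfold yukawaSlope
  positivity

theorem hasDerivAt_exp_neg_mul (a s : ℝ) :
    HasDerivAt (fun t : ℝ => Real.exp (-a * t)) (Real.exp (-a * s) * -a) s := by
  simpa using ((hasDerivAt_id s).const_mul (-a)).exp

theorem tendsto_exp_neg_mul_atTop {a : ℝ} (ha : 0 < a) :
    Tendsto (fun t : ℝ => Real.exp (-a * t)) atTop (nhds 0) := by
  simpa using tendsto_rpow_mul_exp_neg_mul_atTop_nhds_zero 0 a ha

theorem lintegral_yukawaSlope {a C r : ℝ} (ha : 0 < a) (hC : 0 < C) (hr : 0 < r) :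
    ∫⁻ s in Set.Ioi r, ENNReal.ofReal (yukawaSlope a C s) =
      ENNReal.ofReal (Real.exp (-a * r) / (C * r)) := by
  rw [lintegral_Ioi_ofReal_of_hasDerivAt_of_nonneg
    (g := fun s => -(Real.exp (-a * s) / (C * s))) (l := 0)]
  · simp
  · intro s hs
    have hs : 0 < s := hr.trans_le hs
    refine ((hasDerivAt_exp_neg_mul a s).div ((hasDerivAt_id s).const_mul C)
      (by simp [hC.ne', hs.ne'])).neg.congr_deriv ?_
    simp only [yukawaSlope, id]
    field_simp
    ring
  · intro s hs
    exact yukawaSlope_nonneg ha.le hC.le (hr.trans hs).le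
  · simpa using ((tendsto_exp_neg_mul_atTop ha).div_atTop
      (tendsto_id.const_mul_atTop hC)).neg

theorem lintegral_yukawaSlope_mul_sq {a C A : ℝ} (ha : 0 < a) (hC : 0 < C) (hA : 0 ≤ A) :
    ∫⁻ s in Set.Ioi 0, ENNReal.ofReal (yukawaSlope a C s * (A * s ^ 2)) =
      ENNReal.ofReal (2 * A / (C * a)) := by
  have hcongr : ∀ s ∈ Set.Ioi (0 : ℝ), ENNReal.ofReal (yukawaSlope a C s * (A * s ^ 2)) =
      ENNReal.ofReal (A / C * (Real.exp (-a * s) * (a * s + 1))) := by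
    intro s hs
    have hs : 0 < s := hs
    congr 1
    unfold yukawaSlope
    field_simp
  rw [setLIntegral_congr_fun measurableSet_Ioi hcongr,
    lintegral_Ioi_ofReal_of_hasDerivAt_of_nonneg
    (g := fun s => -(A / C * (Real.exp (-a * s) * (s + 2 / a)))) (l := 0)]
  · congr 1
    simp
    field_simp
  · intro s _
    refine (((hasDerivAt_exp_neg_mul a s).mul
      ((hasDerivAt_id s).add_const (2 / a))).const_mul (A / C)).neg.congr_deriv ?_
    simp only [id]
    field_simp
    ring
  · intro s hs
    have hs : 0 < s := hs
    positivity
  · have h1 := tendsto_rpow_mul_exp_neg_mul_atTop_nhds_zero 1 a ha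
    have h2 := (tendsto_exp_neg_mul_atTop ha).mul_const (2 / a)
    have h := ((h1.add h2).const_mul (A / C)).neg
    simp only [Real.rpow_one, zero_mul, add_zero, mul_zero, neg_zero] at h
    refine h.congr fun s => ?_
    ring

theorem Upper2Regular.isLocallyFiniteMeasure {μ : Measure (EuclideanSpace ℝ (Fin 3))} {A : ℝ}
    (h : Upper2Regular μ A) : IsLocallyFiniteMeasure μ :=
  ⟨fun x => ⟨Metric.closedBall x 1, Metric.closedBall_mem_nhds x one_pos,
    (h x 1 one_pos).trans_lt ENNReal.ofReal_lt_top⟩⟩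

theorem ofReal_yukawa_le_lintegral {ε α : ℝ} (hε : 0 < ε) (hα : 0 < α)
    (x y : EuclideanSpace ℝ (Fin 3)) :
    ENNReal.ofReal (yukawa ε α x y) ≤ ∫⁻ s in Set.Ioi 0,
      {p : EuclideanSpace ℝ (Fin 3) × ℝ | dist p.1 x ≤ p.2}.indicator
        (fun p => ENNReal.ofReal (yukawaSlope (α / ε) (4 * π * ε ^ 2) p.2)) (y, s) := by
  rcases eq_or_ne x y with rfl | hxy
  · simp [yukawa]
  have hr : 0 < ‖x - y‖ := norm_pos_iff.2 (sub_ne_zero.2 hxy)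
  calc
    _ = ∫⁻ s in Set.Ioi ‖x - y‖,
        ENNReal.ofReal (yukawaSlope (α / ε) (4 * π * ε ^ 2) s) :=
      (lintegral_yukawaSlope (div_pos hα hε) (by positivity) hr).symm
    _ = ∫⁻ s in Set.Ioi ‖x - y‖, {p : EuclideanSpace ℝ (Fin 3) × ℝ | dist p.1 x ≤ p.2}.indicator
        (fun p => ENNReal.ofReal (yukawaSlope (α / ε) (4 * π * ε ^ 2) p.2)) (y, s) := by
      refine setLIntegral_congr_fun measurableSet_Ioi fun s hs => ?_
      have hmem : dist y x ≤ s := by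
        rw [dist_comm, dist_eq_norm]
        exact le_of_lt hs
      simp [Set.indicator, hmem]
    _ ≤ _ := lintegral_mono_set (Set.Ioi_subset_Ioi hr.le)

theorem yukawa_schur_bound (ε α : ℝ) (hε : 0 < ε) (hα : 0 < α)
    (μ : Measure (EuclideanSpace ℝ (Fin 3))) (A : ℝ) (hA : 0 < A)
    (hreg : Upper2Regular μ A) (x : EuclideanSpace ℝ (Fin 3)) :
    ∫⁻ y, ENNReal.ofReal (yukawa ε α x y) ∂μ ≤ ENNReal.ofReal (A / (2 * π * α * ε)) := by
  have := hreg.isLocallyFiniteMeasure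
  set a := α / ε with ha_def
  set C := 4 * π * ε ^ 2 with hC_def
  have ha : 0 < a := div_pos hα hε
  have hC : 0 < C := by positivity
  set S := {p : EuclideanSpace ℝ (Fin 3) × ℝ | dist p.1 x ≤ p.2}
  have hS : MeasurableSet S := measurableSet_le (by fun_prop) (by fun_prop)
  have hW : Measurable fun s => ENNReal.ofReal (yukawaSlope a C s) :=
    (measurable_yukawaSlope a C).ennreal_ofReal
  calc
    _ ≤ ∫⁻ y, (∫⁻ s in Set.Ioi 0,
        S.indicator (fun p => ENNReal.ofReal (yukawaSlope a C p.2)) (y, s)) ∂μ :=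
      lintegral_mono fun y => ofReal_yukawa_le_lintegral hε hα x y
    _ = ∫⁻ s in Set.Ioi 0, ∫⁻ y,
        S.indicator (fun p => ENNReal.ofReal (yukawaSlope a C p.2)) (y, s) ∂μ :=
      lintegral_lintegral_swap ((hW.comp measurable_snd).indicator hS).aemeasurable
    _ = ∫⁻ s in Set.Ioi 0,
        ENNReal.ofReal (yukawaSlope a C s) * μ (Metric.closedBall x s) := by
      refine lintegral_congr fun s => ?_
      rw [← lintegral_indicator_const Metric.isClosed_closedBall.measurableSet]
      rfl
    _ ≤ ∫⁻ s in Set.Ioi 0, ENNReal.ofReal (yukawaSlope a C s * (A * s ^ 2)) := by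
      refine setLIntegral_mono' measurableSet_Ioi fun s hs => ?_
      rw [ENNReal.ofReal_mul (yukawaSlope_nonneg ha.le hC.le (le_of_lt hs))]
      gcongr
      exact hreg x s hs
    _ = ENNReal.ofReal (2 * A / (C * a)) := lintegral_yukawaSlope_mul_sq ha hC hA.le
    _ = ENNReal.ofReal (A / (2 * π * α * ε)) := by
      congr 1
      rw [ha_def, hC_def]
      field_simp
      ring
end
end

section
/- Let α > 0 and A > 0. There exists a constant C > 0, depending only on α and A, such that for every ε > 0, every Borel measure μ on ℝ³ which is upper 2-regular with constant A, and every x ∈ ℝ³, one has ∫_{ℝ³} 𝒢_ε(x,y)² · |x−y|³ dμ(y) ≤ C/ε. -/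
open MeasureTheory Real Filter
open scoped ENNReal

noncomputable section

theorem summable_succ_pow_mul_exp_neg (k : ℕ) {r : ℝ} (hr : 0 < r) :
    Summable fun n : ℕ => ((n : ℝ) + 1) ^ k * Real.exp (-r * n) := by
  have h := ((summable_nat_add_iff 1).2
    (Real.summable_pow_mul_exp_neg_nat_mul k hr)).mul_left (Real.exp r)
  refine h.congr fun n => ?_
  rw [mul_left_comm, ← Real.exp_add]
  push_cast
  congr 2
  ring

theorem yukawa_sq_mul_norm_cube {ε : ℝ} (hε : 0 < ε) (α : ℝ) (x y : EuclideanSpace ℝ (Fin 3)) :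
    yukawa ε α x y ^ 2 * ‖x - y‖ ^ 3 =
      ‖x - y‖ * Real.exp (-(2 * α) * (‖x - y‖ / ε)) / (16 * π ^ 2 * ε ^ 4) := by
  have hexp : Real.exp (-(2 * α) * (‖x - y‖ / ε)) = Real.exp (-(α / ε) * ‖x - y‖) ^ 2 := by
    rw [← Real.exp_nat_mul]
    push_cast
    congr 1
    ring
  rw [yukawa, hexp]
  rcases eq_or_ne ‖x - y‖ 0 with h | h
  · simp [h]
  · field_simp
    ring

theorem yukawa_sq_mul_norm_cube_le {ε α : ℝ} (hε : 0 < ε) (hα : 0 ≤ α)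
    (x y : EuclideanSpace ℝ (Fin 3)) {n : ℕ} (hn : n ≤ ‖x - y‖ / ε)
    (hn' : ‖x - y‖ ≤ (n + 1) * ε) :
    yukawa ε α x y ^ 2 * ‖x - y‖ ^ 3 ≤
      (n + 1) * Real.exp (-(2 * α) * n) / (16 * π ^ 2 * ε ^ 3) := by
  rw [yukawa_sq_mul_norm_cube hε]
  calc ‖x - y‖ * Real.exp (-(2 * α) * (‖x - y‖ / ε)) / (16 * π ^ 2 * ε ^ 4)
      ≤ (n + 1) * ε * Real.exp (-(2 * α) * n) / (16 * π ^ 2 * ε ^ 4) := by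
        have : -(2 * α) * (‖x - y‖ / ε) ≤ -(2 * α) * n :=
          mul_le_mul_of_nonpos_left hn (by linarith)
        gcongr
    _ = _ := by field_simp

theorem yukawa_sq_weighted_bound (α A : ℝ) (hα : 0 < α) (hA : 0 < A) :
    ∃ C > 0, ∀ ε : ℝ, 0 < ε →
      ∀ μ : Measure (EuclideanSpace ℝ (Fin 3)), Upper2Regular μ A →
        ∀ x : EuclideanSpace ℝ (Fin 3),
          ∫⁻ y, ENNReal.ofReal (yukawa ε α x y ^ 2 * ‖x - y‖ ^ 3) ∂μ ≤
            ENNReal.ofReal (C / ε) := by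
  have hsum := summable_succ_pow_mul_exp_neg 3 (r := 2 * α) (by positivity)
  have hpos : 0 < ∑' n : ℕ, ((n : ℝ) + 1) ^ 3 * Real.exp (-(2 * α) * n) :=
    hsum.tsum_pos (fun n => by positivity) 0 (by positivity)
  refine ⟨A / (16 * π ^ 2) * ∑' n : ℕ, ((n : ℝ) + 1) ^ 3 * Real.exp (-(2 * α) * n),
    by positivity, fun ε hε μ hμ x => ?_⟩
  let c : ℕ → ℝ := fun n => (n + 1) * Real.exp (-(2 * α) * n) / (16 * π ^ 2 * ε ^ 3)
  let B : ℕ → Set (EuclideanSpace ℝ (Fin 3)) := fun n => Metric.closedBall x ((n + 1) * ε)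
  have hB : ∀ n, MeasurableSet (B n) := fun n => Metric.isClosed_closedBall.measurableSet
  calc ∫⁻ y, ENNReal.ofReal (yukawa ε α x y ^ 2 * ‖x - y‖ ^ 3) ∂μ
      ≤ ∫⁻ y, ∑' n, (B n).indicator (fun _ => ENNReal.ofReal (c n)) y ∂μ := by
        refine lintegral_mono fun y => ?_
        set n := ⌊‖x - y‖ / ε⌋₊
        have hn : (n : ℝ) ≤ ‖x - y‖ / ε := Nat.floor_le (by positivity)
        have hn' : ‖x - y‖ ≤ (n + 1) * ε :=
          ((div_lt_iff₀ hε).1 (Nat.lt_floor_add_one _)).le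
        have hy : y ∈ B n := by
          rwa [Metric.mem_closedBall, dist_comm, dist_eq_norm]
        refine le_trans ?_ (ENNReal.le_tsum n)
        rw [Set.indicator_of_mem hy]
        exact ENNReal.ofReal_le_ofReal (yukawa_sq_mul_norm_cube_le hε hα.le x y hn hn')
    _ = ∑' n, ENNReal.ofReal (c n) * μ (B n) := by
        rw [lintegral_tsum fun n => (measurable_const.indicator (hB n)).aemeasurable]
        simp_rw [lintegral_indicator_const (hB _)]
    _ ≤ ∑' n : ℕ, ENNReal.ofReal
          (A / (16 * π ^ 2) / ε * (((n : ℝ) + 1) ^ 3 * Real.exp (-(2 * α) * n))) := by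
        refine ENNReal.tsum_le_tsum fun n => ?_
        refine (mul_le_mul_right (hμ x ((n + 1) * ε) (by positivity)) _).trans_eq ?_
        rw [← ENNReal.ofReal_mul (by positivity)]
        congr 1
        simp only [c]
        field_simp
    _ = _ := by
        rw [← ENNReal.ofReal_tsum_of_nonneg (fun n => by positivity) (hsum.mul_left _),
          tsum_mul_left]
        congr 1
        ring
end
end
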